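/- Projection operators commute with the monodromy matrix at complete 2s-strings (Lemma, Section 3.9): Let s be a positive half-integer (2s ∈ ℤ_{≥1}), N_s ≥ 1, L = 2sN_s; let η, ξ₁,…,ξ_{N_s} ∈ ℂ, q = e^η with q^{2k} ≠ 1 for 1 ≤ k ≤ 2s; let the inhomogeneous parameters form complete 2s-strings: w_{2s(b−1)+β} = ξ_b − (β−1)η for b = 1,…,N_s and β = 1,…,2s. Let λ ∈ ℂ satisfy sinh(λ − w_j + η) ≠ 0 for all 1 ≤ j ≤ L, and let T(λ) = R⁺_{0L}(λ−w_L) ⋯ R⁺_{02}(λ−w₂) R⁺_{01}(λ−w₁) act on ℂ²_0 ⊗ (ℂ²)^{⊗L}. Let P = P^{(2s)}⊗⋯⊗P^{(2s)} and P̃ = P̃^{(2s)}⊗⋯⊗P̃^{(2s)} (one factor per consecutive block of 2s tensor factors of (ℂ²)^{⊗L}), acting trivially on the auxiliary factor ℂ²_0. Then (1⊗P) T(λ) (1⊗P) = (1⊗P) T(λ) and (1⊗P) T(λ) (1⊗P̃) = (1⊗P) T(λ). -/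

import Mathlib

open scoped BigOperators

/-- The q-integer [k]_q = (q^k − q^{−k})/(q − q^{−1}). -/
noncomputable def qInt (q : ℂ) (k : ℕ) : ℂ := (q ^ k - q⁻¹ ^ k) / (q - q⁻¹)

/-- The q-factorial [k]_q!. -/
noncomputable def qFact (q : ℂ) : ℕ → ℂ
  | 0 => 1
  | k + 1 => qInt q (k + 1) * qFact q k

/-- The q-binomial coefficient [l ¦ n]_q. -/
noncomputable def qBinom (q : ℂ) (l n : ℕ) : ℂ := qFact q l / (qFact q (l - n) * qFact q n)

/-- The set of down-spin positions of a basis state of (ℂ²)^{⊗l}. -/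
def downs {l : ℕ} (σ : Fin l → Fin 2) : Finset (Fin l) := Finset.univ.filter fun j => σ j = 1

/-- The 1-based sum i₁ + ⋯ + i_n of down-spin positions. -/
def idxSum {l : ℕ} (σ : Fin l → Fin 2) : ℤ := ∑ j ∈ downs σ, ((j : ℕ) + 1 : ℤ)

/-- The vector ||l,n⟩ in coordinates: its coefficient on the basis state σ. -/
noncomputable def ketV (q : ℂ) (l n : ℕ) : (Fin l → Fin 2) → ℂ := fun σ =>
  if (downs σ).card = n then
    q ^ (idxSum σ - (n : ℤ) * (l : ℤ) + ((n * (n - 1) / 2 : ℕ) : ℤ)) else 0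

/-- The covector ⟨l,n|| in coordinates. -/
noncomputable def braV (q : ℂ) (l n : ℕ) : (Fin l → Fin 2) → ℂ := fun σ =>
  (qBinom q l n)⁻¹ * q ^ ((n : ℤ) * ((l : ℤ) - (n : ℤ))) *
    (if (downs σ).card = n then
      q ^ (idxSum σ - (n : ℤ) * (l : ℤ) + ((n * (n - 1) / 2 : ℕ) : ℤ)) else 0)

/-- The conjugate vector ||l,n⟩~ in coordinates. -/
noncomputable def ketTilde (q : ℂ) (l n : ℕ) : (Fin l → Fin 2) → ℂ := fun σ =>
  qBinom q l n * q ^ (-(n : ℤ) * ((l : ℤ) - (n : ℤ))) / (Nat.choose l n : ℂ) *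
    (if (downs σ).card = n then
      q ^ (-idxSum σ + (n : ℤ) * (l : ℤ) - ((n * (n - 1) / 2 : ℕ) : ℤ)) else 0)

/-- The projector P^{(l)} = Σ_n ||l,n⟩⟨l,n||. -/
noncomputable def projP (q : ℂ) (l : ℕ) : Matrix (Fin l → Fin 2) (Fin l → Fin 2) ℂ :=
  ∑ n ∈ Finset.range (l + 1), Matrix.vecMulVec (ketV q l n) (braV q l n)

/-- The projector P̃^{(l)} = Σ_n ||l,n⟩~ ⟨l,n||. -/
noncomputable def projPt (q : ℂ) (l : ℕ) : Matrix (Fin l → Fin 2) (Fin l → Fin 2) ℂ :=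
  ∑ n ∈ Finset.range (l + 1), Matrix.vecMulVec (ketTilde q l n) (braV q l n)

/-- Entry of the asymmetric R-matrix R⁺(u) at row (a,b), column (c,d)
(ordered basis |00⟩,|01⟩,|10⟩,|11⟩ of ℂ² ⊗ ℂ²). -/
noncomputable def RplusEnt (η u : ℂ) (a b c d : Fin 2) : ℂ :=
  if a = c ∧ b = d then (if a = b then 1 else Complex.sinh u / Complex.sinh (u + η))
  else if c = b ∧ d = a ∧ a ≠ b then
    (if a = 0 then Complex.exp (-u) * Complex.sinh η / Complex.sinh (u + η)
     else Complex.exp u * Complex.sinh η / Complex.sinh (u + η))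
  else 0

/-- R⁺_{0j}(u): the R-matrix acting on the auxiliary space ℂ²₀ and the j-th
quantum factor of (ℂ²)^{⊗L}. -/
noncomputable def R0j (η : ℂ) (L : ℕ) (j : Fin L) (u : ℂ) :
    Matrix (Fin 2 × (Fin L → Fin 2)) (Fin 2 × (Fin L → Fin 2)) ℂ :=
  Matrix.of fun p r =>
    RplusEnt η u p.1 (p.2 j) r.1 (r.2 j) * (if ∀ k, k ≠ j → p.2 k = r.2 k then 1 else 0)

/-- The monodromy matrix T(λ) = R⁺_{0L}(λ−w_L) ⋯ R⁺_{02}(λ−w₂) R⁺_{01}(λ−w₁). -/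
noncomputable def monodromy (η : ℂ) (L : ℕ) (lam : ℂ) (w : Fin L → ℂ) :
    Matrix (Fin 2 × (Fin L → Fin 2)) (Fin 2 × (Fin L → Fin 2)) ℂ :=
  (((List.finRange L).reverse.map fun j => R0j η L j (lam - w j)).prod)

/-- The position of the β-th site of the b-th block of 2s = t consecutive sites. -/
def blockIdx (t N : ℕ) (b : Fin N) (β : Fin t) : Fin (t * N) :=
  ⟨t * b.val + β.val, by
    have hb := b.isLt
    have hβ := β.isLt
    calc t * b.val + β.val < t * b.val + t := by omega
      _ = t * (b.val + 1) := by ring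
      _ ≤ t * N := Nat.mul_le_mul_left t hb⟩

/-- The operator 1 ⊗ (A ⊗ A ⊗ ⋯ ⊗ A) on ℂ²₀ ⊗ (ℂ²)^{⊗tN}, where each factor A acts
on a consecutive block of t tensor factors of (ℂ²)^{⊗tN}. -/
noncomputable def oneTensor (t N : ℕ) (A : Matrix (Fin t → Fin 2) (Fin t → Fin 2) ℂ) :
    Matrix (Fin 2 × (Fin (t * N) → Fin 2)) (Fin 2 × (Fin (t * N) → Fin 2)) ℂ :=
  Matrix.of fun p r =>
    (if p.1 = r.1 then 1 else 0) *
      ∏ b : Fin N, A (fun β => p.2 (blockIdx t N b β)) (fun β => r.2 (blockIdx t N b β))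

/-- A covector on ℂ²₀ ⊗ (ℂ²)^{⊗L} is q-symmetric at the sites `i`, `j` when moving a down spin
from `i` to `j` multiplies its coefficient by `q`. -/
def QSymm {L : ℕ} (q : ℂ) (i j : Fin L) (x : Fin 2 × (Fin L → Fin 2) → ℂ) : Prop :=
  ∀ a τ, x (a, Function.update (Function.update τ i 0) j 1) =
    q * x (a, Function.update (Function.update τ i 1) j 0)

lemma vecMul_R0j (η u : ℂ) {L : ℕ} (k : Fin L) (x : Fin 2 × (Fin L → Fin 2) → ℂ)
    (c : Fin 2) (τ : Fin L → Fin 2) :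
    Matrix.vecMul x (R0j η L k u) (c, τ) =
      ∑ a, ∑ d, x (a, Function.update τ k d) * RplusEnt η u a d c (τ k) := by
  rw [Matrix.vecMul, dotProduct, Fintype.sum_prod_type]
  refine Finset.sum_congr rfl fun a _ => ?_
  symm
  refine Finset.sum_of_injOn (fun d => Function.update τ k d)
    ((Function.update_injective τ k).injOn) (by simp) ?_ ?_
  · intro ρ _ hρ
    have : ¬ ∀ k', k' ≠ k → ρ k' = τ k' := by
      intro h
      apply hρ
      refine ⟨ρ k, by simp, ?_⟩
      funext k'
      by_cases hk : k' = k
      · subst hk; simp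
      · simp [hk, h k' hk]
    simp [R0j, this]
  · intro d _
    have : ∀ k', k' ≠ k → Function.update τ k d k' = τ k' := by
      intro k' hk
      simp [hk]
    simp only [R0j, Matrix.of_apply, Function.update_self]
    rw [if_pos this, mul_one]

lemma QSymm.vecMul_R0j_of_ne {L : ℕ} {q η u : ℂ} {i j k : Fin L} (hi : k ≠ i) (hj : k ≠ j)
    {x : Fin 2 × (Fin L → Fin 2) → ℂ} (hx : QSymm q i j x) :
    QSymm q i j (Matrix.vecMul x (R0j η L k u)) := by
  intro c τ
  rw [vecMul_R0j, vecMul_R0j, Finset.mul_sum]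
  refine Finset.sum_congr rfl fun a _ => ?_
  rw [Finset.mul_sum]
  refine Finset.sum_congr rfl fun d _ => ?_
  have h := hx a (Function.update τ k d)
  have e : ∀ f g : Fin 2, Function.update (Function.update (Function.update τ i f) j g) k d =
      Function.update (Function.update (Function.update τ k d) i f) j g := by
    intro f g
    rw [Function.update_comm hj.symm, Function.update_comm hi.symm]
  rw [e, e, h, Function.update_of_ne hj, Function.update_of_ne hi, Function.update_of_ne hj,
    Function.update_of_ne hi]
  ring

lemma QSymm.vecMul_R0j_pair {L : ℕ} {η u : ℂ} {i j : Fin L} (hij : i ≠ j)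
    (h₁ : Complex.sinh (u + η) ≠ 0) (h₂ : Complex.sinh (u + η + η) ≠ 0)
    {x : Fin 2 × (Fin L → Fin 2) → ℂ} (hx : QSymm (Complex.exp η) i j x) :
    QSymm (Complex.exp η) i j
      (Matrix.vecMul (Matrix.vecMul x (R0j η L j (u + η))) (R0j η L i u)) := by
  intro c τ
  have e : ∀ d e f : Fin 2, Function.update (Function.update (Function.update τ i d) j e) i f =
      Function.update (Function.update τ i f) j e := by
    intro d e f
    rw [Function.update_comm hij.symm, Function.update_idem]
  have h0 := hx 0 τ
  have h1 := hx 1 τ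
  simp only [vecMul_R0j, e, Function.update_idem, Function.update_self,
    Function.update_of_ne hij, Fin.sum_univ_two, RplusEnt]
  simp only [h0, h1, Fin.isValue]
  generalize x (0, Function.update (Function.update τ i 1) j 0) = x010
  generalize x (1, Function.update (Function.update τ i 1) j 0) = x110
  generalize x (0, Function.update (Function.update τ i 0) j 0) = x000
  generalize x (1, Function.update (Function.update τ i 0) j 0) = x100
  generalize x (0, Function.update (Function.update τ i 1) j 1) = x011
  generalize x (1, Function.update (Function.update τ i 1) j 1) = x111
  have hU := Complex.exp_ne_zero u
  have hQ := Complex.exp_ne_zero η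
  fin_cases c <;> simp <;> field_simp <;>
  simp only [Complex.sinh, Complex.exp_add, neg_add, Complex.exp_neg] <;> field_simp <;> ring

lemma eq_of_card_downs_eq {l : ℕ} {α : Type*} (f : (Fin l → Fin 2) → α)
    (hf : ∀ (i j : Fin l), (j : ℕ) = i + 1 → ∀ σ,
      f (Function.update (Function.update σ i 0) j 1) =
        f (Function.update (Function.update σ i 1) j 0))
    {σ τ : Fin l → Fin 2} (h : (downs σ).card = (downs τ).card) : f σ = f τ := by
  have hswap : ∀ (i j : Fin l), (j : ℕ) = i + 1 → ∀ σ, f (σ ∘ Equiv.swap i j) = f σ := by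
    intro i j hj σ
    have hij : i ≠ j := by rintro rfl; omega
    have hv : Function.update (Function.update σ i (σ i)) j (σ j) = σ := by simp
    have hs : σ ∘ Equiv.swap i j = Function.update (Function.update σ i (σ j)) j (σ i) := by
      rw [Equiv.comp_swap_eq_update, Function.update_comm hij]
    have h := hf i j hj σ
    rw [hs]
    nth_rewrite 4 [← hv]
    rcases Fin.exists_fin_two.mp ⟨σ i, rfl⟩ with hi | hi <;>
      rcases Fin.exists_fin_two.mp ⟨σ j, rfl⟩ with hj | hj <;>
      simp only [hi, hj, h]
  have key : ∀ e : Equiv.Perm (Fin l), ∀ σ, f (σ ∘ e) = f σ := by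
    cases l with
    | zero => intro e σ; congr 1; exact Subsingleton.elim _ _
    | succ l =>
      intro e
      have he : e ∈ Submonoid.closure
          (Set.range fun i : Fin l => Equiv.swap i.castSucc i.succ) := by
        rw [Equiv.Perm.mclosure_swap_castSucc_succ]; trivial
      induction he using Submonoid.closure_induction with
      | mem x hx =>
        obtain ⟨i, rfl⟩ := hx
        exact hswap _ _ (by simp)
      | one => intro σ; rfl
      | mul x y _ _ hx hy =>
        intro σ
        rw [Equiv.Perm.coe_mul, ← Function.comp_assoc, hy, hx]
  have hc : Fintype.card {x // σ x = 1} = Fintype.card {x // τ x = 1} := by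
    rw [Fintype.card_subtype, Fintype.card_subtype]; exact h
  let e := (Fintype.equivOfCardEq hc).extendSubtype
  rw [← key e τ]
  congr 1
  funext x
  by_cases hx : σ x = 1
  · rw [hx]; exact ((Fintype.equivOfCardEq hc).extendSubtype_mem x hx).symm
  · have h2 := (Fintype.equivOfCardEq hc).extendSubtype_not_mem x hx
    change ¬ τ (e x) = 1 at h2
    simp only [Function.comp]
    omega

lemma eq_of_forall_update_eq {ι V α : Type*} [Fintype ι] [DecidableEq ι] (r : V → V → Prop)
    (F : (ι → V) → α) (hF : ∀ σ b v, r (σ b) v → F (Function.update σ b v) = F σ)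
    {σ ρ : ι → V} (h : ∀ b, r (σ b) (ρ b)) : F ρ = F σ := by
  have key : ∀ s : Finset ι, F (s.piecewise ρ σ) = F σ := by
    intro s
    induction s using Finset.induction_on with
    | empty => simp
    | insert b s hb ih =>
      rw [Finset.piecewise_insert, hF, ih]
      rw [Finset.piecewise_eq_of_notMem _ _ _ hb]
      exact h b
  simpa using key Finset.univ

lemma idxSum_eq {l : ℕ} (σ : Fin l → Fin 2) :
    idxSum σ = ∑ j, if σ j = 1 then ((j : ℕ) + 1 : ℤ) else 0 := by
  rw [idxSum, downs, Finset.sum_filter]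

lemma card_downs_eq {l : ℕ} (σ : Fin l → Fin 2) :
    (downs σ).card = ∑ j, if σ j = 1 then 1 else 0 := by
  rw [downs, Finset.card_filter]

lemma idxSum_update_pair {l : ℕ} (σ : Fin l → Fin 2) {i j : Fin l} (hj : (j : ℕ) = i + 1) :
    idxSum (Function.update (Function.update σ i 0) j 1) =
      idxSum (Function.update (Function.update σ i 1) j 0) + 1 := by
  have hij : i ≠ j := by rintro rfl; omega
  rw [idxSum_eq, idxSum_eq, ← sub_eq_iff_eq_add', ← Finset.sum_sub_distrib,
    Finset.sum_eq_add i j hij]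
  · simp [hij, hj]
    ring
  · intro k _ hk
    simp [hk.1, hk.2]
  · simp
  · simp

lemma card_downs_update_pair {l : ℕ} (σ : Fin l → Fin 2) {i j : Fin l} (hij : i ≠ j) :
    (downs (Function.update (Function.update σ i 0) j 1)).card =
      (downs (Function.update (Function.update σ i 1) j 0)).card := by
  rw [card_downs_eq, card_downs_eq, ← Equiv.sum_comp (Equiv.swap i j)]
  refine Finset.sum_congr rfl fun k _ => ?_
  rcases eq_or_ne k i with rfl | hki
  · simp [hij]
  rcases eq_or_ne k j with rfl | hkj
  · simp [hij]
  · simp [Equiv.swap_apply_of_ne_of_ne hki hkj, hki, hkj]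

lemma projP_update_pair {q : ℂ} (hq : q ≠ 0) {l : ℕ} (ρ σ : Fin l → Fin 2) {i j : Fin l}
    (hj : (j : ℕ) = i + 1) :
    projP q l ρ (Function.update (Function.update σ i 0) j 1) =
      q * projP q l ρ (Function.update (Function.update σ i 1) j 0) := by
  have hij : i ≠ j := by rintro rfl; omega
  simp only [projP, Matrix.sum_apply, Matrix.vecMulVec_apply, Finset.mul_sum, braV,
    card_downs_update_pair σ hij, idxSum_update_pair σ hj]
  refine Finset.sum_congr rfl fun n _ => ?_
  split_ifs
  · rw [add_sub_right_comm, add_right_comm, zpow_add_one₀ hq]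
    ring
  · simp

lemma qFact_ne_zero {q : ℂ} (hq : q ≠ 0) {t : ℕ} (hroot : ∀ k : ℕ, 1 ≤ k → k ≤ t → q ^ (2 * k) ≠ 1)
    {k : ℕ} (hk : k ≤ t) : qFact q k ≠ 0 := by
  have hpow : ∀ k : ℕ, 1 ≤ k → k ≤ t → q ^ k - q⁻¹ ^ k ≠ 0 := by
    intro k h1 h2 h
    apply hroot k h1 h2
    have : q ^ k * q ^ k = 1 := by
      rw [sub_eq_zero, inv_pow] at h
      nth_rewrite 1 [h]
      exact inv_mul_cancel₀ (pow_ne_zero _ hq)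
    rw [two_mul, pow_add, this]
  induction k with
  | zero => simp [qFact]
  | succ k ih =>
    rw [qFact, qInt]
    refine mul_ne_zero (div_ne_zero (hpow _ (by omega) hk) ?_) (ih (by omega))
    simpa using hpow 1 le_rfl (by omega)

/-- The generating sum of `q^{2(i₁ + ⋯ + i_n)}` over configurations with `n` down spins. -/
noncomputable def sqWeightSum (q : ℂ) (l n : ℕ) : ℂ :=
  ∑ σ : Fin l → Fin 2, if (downs σ).card = n then q ^ (2 * idxSum σ) else 0

lemma idxSum_snoc {l : ℕ} (σ : Fin l → Fin 2) (a : Fin 2) :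
    idxSum (Fin.snoc σ a : Fin (l + 1) → Fin 2) = idxSum σ + if a = 1 then (l + 1 : ℤ) else 0 := by
  simp [idxSum_eq, Fin.sum_univ_castSucc]

lemma card_downs_snoc {l : ℕ} (σ : Fin l → Fin 2) (a : Fin 2) :
    (downs (Fin.snoc σ a : Fin (l + 1) → Fin 2)).card = (downs σ).card + if a = 1 then 1 else 0 := by
  simp only [card_downs_eq, Fin.sum_univ_castSucc, Fin.snoc_castSucc, Fin.snoc_last]

lemma sum_snoc {l : ℕ} (f : (Fin (l + 1) → Fin 2) → ℂ) :
    ∑ σ, f σ = ∑ σ : Fin l → Fin 2, f (Fin.snoc σ 0) + ∑ σ : Fin l → Fin 2, f (Fin.snoc σ 1) := by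
  rw [← Equiv.sum_comp (Fin.snocEquiv fun _ => Fin 2), Fintype.sum_prod_type, Fin.sum_univ_two]
  rfl

lemma sqWeightSum_succ_succ {q : ℂ} (hq : q ≠ 0) (l n : ℕ) :
    sqWeightSum q (l + 1) (n + 1) =
      sqWeightSum q l (n + 1) + q ^ (2 * (l + 1)) * sqWeightSum q l n := by
  simp only [sqWeightSum, sum_snoc, idxSum_snoc, card_downs_snoc, Finset.mul_sum]
  congr 1
  · simp
  · refine Finset.sum_congr rfl fun σ _ => ?_
    simp only [if_true, add_left_inj, mul_ite, mul_zero]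
    refine if_congr Iff.rfl ?_ rfl
    rw [mul_add, zpow_add₀ hq, mul_comm]
    norm_cast

lemma sqWeightSum_zero_right {q : ℂ} (l : ℕ) : sqWeightSum q l 0 = 1 := by
  induction l with
  | zero => simp [sqWeightSum, downs, idxSum]
  | succ l ih =>
    rw [sqWeightSum] at ih ⊢
    rw [sum_snoc]
    simpa [idxSum_snoc, card_downs_snoc] using ih

lemma sqWeightSum_of_lt {q : ℂ} {l n : ℕ} (h : l < n) : sqWeightSum q l n = 0 := by
  refine Finset.sum_eq_zero fun σ _ => if_neg ?_
  have := (downs σ).card_le_univ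
  rw [Fintype.card_fin] at this
  omega

/-- The q-binomial theorem for the squared norm of `||l,n⟩`. -/
lemma sqWeightSum_mul_qFact {q : ℂ} (hq : q ≠ 0) (n m : ℕ) :
    sqWeightSum q (n + m) n * (qFact q m * qFact q n) =
      q ^ (n * (n + m + 1)) * qFact q (n + m) := by
  induction h : n + m generalizing n m with
  | zero =>
    obtain ⟨rfl, rfl⟩ : n = 0 ∧ m = 0 := by omega
    simp [sqWeightSum_zero_right, qFact]
  | succ l ih =>
    cases n with
    | zero =>
      obtain rfl : m = l + 1 := by omega
      simp [sqWeightSum_zero_right, qFact]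
    | succ n =>
      have h2 : sqWeightSum q l n * (qFact q m * qFact q n) =
          q ^ (n * (l + 1)) * qFact q l := ih n m (by omega)
      have h1 : sqWeightSum q l (n + 1) * (qFact q m * qFact q (n + 1)) =
          qInt q m * (q ^ ((n + 1) * (l + 1)) * qFact q l) := by
        cases m with
        | zero => rw [sqWeightSum_of_lt (by omega)]; simp [qInt]
        | succ m => rw [← ih (n + 1) m (by omega), qFact]; ring
      have hid : qInt q m * q ^ ((n + 1) * (l + 1)) +
          q ^ (2 * (l + 1)) * qInt q (n + 1) * q ^ (n * (l + 1)) =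
          q ^ ((n + 1) * (l + 1 + 1)) * qInt q (l + 1) := by
        obtain rfl : l = n + m := by omega
        simp only [qInt, inv_pow]
        rw [div_mul_eq_mul_div, mul_div_assoc', div_mul_eq_mul_div, ← add_div, mul_div_assoc']
        congr 1
        field_simp
        ring
      rw [sqWeightSum_succ_succ hq, add_mul, h1, qFact, qFact]
      linear_combination (q ^ (2 * (l + 1)) * qInt q (n + 1)) * h2 + qFact q l * hid

lemma card_filter_downs (l n : ℕ) :
    (Finset.univ.filter fun σ : Fin l → Fin 2 => (downs σ).card = n).card = l.choose n := by
  conv_rhs => rw [← Finset.card_fin l, ← Finset.card_powersetCard]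
  refine Finset.card_nbij' downs (fun s j => if j ∈ s then 1 else 0) ?_ ?_ ?_ ?_
  · intro σ hσ
    simpa [Finset.mem_powersetCard] using hσ
  · intro s hs
    rw [Finset.mem_coe, Finset.mem_powersetCard] at hs
    rw [Finset.mem_coe, Finset.mem_filter]
    simp [downs, hs.2]
  · intro σ _
    funext j
    by_cases h : σ j = 1
    · simp [downs, h]
    · simp only [downs, Finset.mem_filter, Finset.mem_univ, h, and_false, if_false]
      omega
  · intro s _
    ext j
    simp [downs]

lemma card_downs_le {l : ℕ} (σ : Fin l → Fin 2) : (downs σ).card ≤ l := by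
  simpa using (downs σ).card_le_univ

lemma projP_apply (q : ℂ) {l : ℕ} (v s : Fin l → Fin 2) :
    projP q l v s = ketV q l (downs s).card v * braV q l (downs s).card s := by
  rw [projP, Matrix.sum_apply, Finset.sum_eq_single (downs s).card]
  · rfl
  · intro n _ hn
    simp [Matrix.vecMulVec_apply, braV, hn.symm]
  · intro h
    exact absurd (Finset.mem_range.mpr (Nat.lt_succ_of_le (card_downs_le s))) h

lemma projPt_apply (q : ℂ) {l : ℕ} (v s : Fin l → Fin 2) :
    projPt q l v s = ketTilde q l (downs s).card v * braV q l (downs s).card s := by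
  rw [projPt, Matrix.sum_apply, Finset.sum_eq_single (downs s).card]
  · rfl
  · intro n _ hn
    simp [Matrix.vecMulVec_apply, braV, hn.symm]
  · intro h
    exact absurd (Finset.mem_range.mpr (Nat.lt_succ_of_le (card_downs_le s))) h

lemma two_mul_half_mul_pred (n : ℕ) :
    2 * ((n * (n - 1) / 2 : ℕ) : ℤ) = (n : ℤ) * n - n := by
  have h := Nat.two_mul_div_two_of_even (Nat.even_mul_pred_self n)
  cases n with
  | zero => simp
  | succ n =>
    have h' := congrArg (Nat.cast : ℕ → ℤ) h
    rw [Nat.cast_mul, Nat.cast_ofNat] at h'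
    rw [h', Nat.add_sub_cancel]
    push_cast
    ring

lemma qBinom_ne_zero {q : ℂ} (hq : q ≠ 0) {t : ℕ}
    (hroot : ∀ k : ℕ, 1 ≤ k → k ≤ t → q ^ (2 * k) ≠ 1) {n : ℕ} (hn : n ≤ t) :
    qBinom q t n ≠ 0 :=
  div_ne_zero (qFact_ne_zero hq hroot le_rfl)
    (mul_ne_zero (qFact_ne_zero hq hroot (Nat.sub_le _ _)) (qFact_ne_zero hq hroot hn))

lemma sqWeightSum_eq {q : ℂ} (hq : q ≠ 0) {t : ℕ}
    (hroot : ∀ k : ℕ, 1 ≤ k → k ≤ t → q ^ (2 * k) ≠ 1) {n : ℕ} (hn : n ≤ t) :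
    sqWeightSum q t n = q ^ (n * (t + 1)) * qBinom q t n := by
  have h := sqWeightSum_mul_qFact hq n (t - n)
  rw [Nat.add_sub_cancel' hn] at h
  rw [qBinom, mul_div_assoc', eq_div_iff, h]
  exact mul_ne_zero (qFact_ne_zero hq hroot (Nat.sub_le _ _)) (qFact_ne_zero hq hroot hn)

lemma sum_zpow_mul_projP {q : ℂ} (hq : q ≠ 0) {t : ℕ}
    (hroot : ∀ k : ℕ, 1 ≤ k → k ≤ t → q ^ (2 * k) ≠ 1) (s : Fin t → Fin 2) :
    ∑ v, q ^ (idxSum v - idxSum s) * projP q t v s = 1 := by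
  simp only [projP_apply]
  have hn := card_downs_le s
  have hB := qBinom_ne_zero hq hroot hn
  have hS := sqWeightSum_eq hq hroot hn
  have hD := two_mul_half_mul_pred (downs s).card
  set n := (downs s).card with hns
  set D : ℤ := ((n * (n - 1) / 2 : ℕ) : ℤ) with hD'
  have hterm : ∀ v : Fin t → Fin 2,
      q ^ (idxSum v - idxSum s) * (ketV q t n v * braV q t n s) =
      ((qBinom q t n)⁻¹ * q ^ (-(n * (t + 1) : ℕ) : ℤ)) *
        (if (downs v).card = n then q ^ (2 * idxSum v) else 0) := by
    intro v
    rw [ketV, braV, if_pos hns.symm, ← hD']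
    split_ifs
    · rw [mul_assoc (qBinom q t n)⁻¹, mul_left_comm _ (qBinom q t n)⁻¹,
        mul_left_comm _ (qBinom q t n)⁻¹, mul_assoc (qBinom q t n)⁻¹]
      simp only [← zpow_add₀ hq]
      congr 2
      push_cast
      linarith
    · simp
  simp only [hterm]
  rw [← Finset.mul_sum, ← sqWeightSum, hS, zpow_neg, zpow_natCast]
  field_simp

lemma sum_zpow_mul_projPt {q : ℂ} (hq : q ≠ 0) {t : ℕ}
    (hroot : ∀ k : ℕ, 1 ≤ k → k ≤ t → q ^ (2 * k) ≠ 1) (s : Fin t → Fin 2) :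
    ∑ v, q ^ (idxSum v - idxSum s) * projPt q t v s = 1 := by
  simp only [projPt_apply]
  have hn := card_downs_le s
  have hB := qBinom_ne_zero hq hroot hn
  have hC : (t.choose (downs s).card : ℂ) ≠ 0 := by
    exact_mod_cast (Nat.choose_pos hn).ne'
  set n := (downs s).card with hns
  set D : ℤ := ((n * (n - 1) / 2 : ℕ) : ℤ) with hD
  have hterm : ∀ v : Fin t → Fin 2,
      q ^ (idxSum v - idxSum s) * (ketTilde q t n v * braV q t n s) =
      (t.choose n : ℂ)⁻¹ * (if (downs v).card = n then 1 else 0) := by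
    intro v
    rw [ketTilde, braV, if_pos hns.symm, ← hD]
    split_ifs
    · have h1 : q ^ (idxSum v - idxSum s) * (q ^ (-(n : ℤ) * ((t : ℤ) - n)) *
          (q ^ (-idxSum v + (n : ℤ) * t - D) * (q ^ ((n : ℤ) * ((t : ℤ) - n)) *
            q ^ (idxSum s - (n : ℤ) * t + D)))) = 1 := by
        simp only [← zpow_add₀ hq]
        convert zpow_zero q using 2
        ring
      rw [mul_one, ← mul_one (t.choose n : ℂ)⁻¹, ← h1]
      field_simp
    · simp
  simp only [hterm]
  rw [← Finset.mul_sum, Finset.sum_boole, card_filter_downs, inv_mul_cancel₀ hC]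

lemma blockIdx_inj {t N : ℕ} {b b' : Fin N} {β β' : Fin t} :
    blockIdx t N b β = blockIdx t N b' β' ↔ b = b' ∧ β = β' := by
  refine ⟨fun h => ?_, fun ⟨h₁, h₂⟩ => by rw [h₁, h₂]⟩
  have h' : t * b.val + β.val = t * b'.val + β'.val := congrArg Fin.val h
  have ht : 0 < t := by have := β.isLt; omega
  have hdiv := congrArg (· / t) h'
  simp only [Nat.mul_add_div ht, Nat.div_eq_of_lt β.isLt, Nat.div_eq_of_lt β'.isLt] at hdiv
  have hb : b = b' := Fin.ext (by omega)
  subst hb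
  exact ⟨rfl, Fin.ext (by omega)⟩

/-- Splitting a configuration of `tN` sites into `N` blocks of `t` sites. -/
noncomputable def splitBlocks (t N : ℕ) :
    (Fin (t * N) → Fin 2) ≃ (Fin N → Fin t → Fin 2) :=
  ((Equiv.ofBijective (fun p : Fin N × Fin t => blockIdx t N p.1 p.2)
    ((Fintype.bijective_iff_injective_and_card _).mpr
      ⟨fun p p' h => Prod.ext (blockIdx_inj.mp h).1 (blockIdx_inj.mp h).2,
        by simp [mul_comm]⟩)).symm.arrowCongr (Equiv.refl _)).trans (Equiv.curry _ _ _)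

lemma splitBlocks_apply {t N : ℕ} (τ : Fin (t * N) → Fin 2) (b : Fin N) :
    splitBlocks t N τ b = fun β => τ (blockIdx t N b β) := rfl

lemma splitBlocks_update {t N : ℕ} (τ : Fin (t * N) → Fin 2) (b : Fin N) (β : Fin t) (d : Fin 2) :
    splitBlocks t N (Function.update τ (blockIdx t N b β) d) =
      Function.update (splitBlocks t N τ) b (Function.update (splitBlocks t N τ b) β d) := by
  funext b' β'
  rw [splitBlocks_apply]
  by_cases hb : b' = b
  · subst hb
    by_cases hβ : β' = β
    · subst hβ; simp
    · simp [hβ, blockIdx_inj, splitBlocks_apply]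
  · simp [hb, blockIdx_inj, splitBlocks_apply]

lemma splitBlocks_symm_update {t N : ℕ} (ρ : Fin N → Fin t → Fin 2) (b : Fin N)
    (v : Fin t → Fin 2) (β : Fin t) (d : Fin 2) :
    (splitBlocks t N).symm (Function.update ρ b (Function.update v β d)) =
      Function.update ((splitBlocks t N).symm (Function.update ρ b v)) (blockIdx t N b β) d := by
  rw [Equiv.symm_apply_eq, splitBlocks_update]
  simp

lemma oneTensor_apply {t N : ℕ} (A : Matrix (Fin t → Fin 2) (Fin t → Fin 2) ℂ)
    (p r : Fin 2 × (Fin (t * N) → Fin 2)) :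
    oneTensor t N A p r = (if p.1 = r.1 then 1 else 0) *
      ∏ b, A (splitBlocks t N p.2 b) (splitBlocks t N r.2 b) := rfl

lemma prod_comp_update {ι V : Type*} [Fintype ι] [DecidableEq ι] (g : ι → V → ℂ) (σ : ι → V)
    (b : ι) (v : V) :
    ∏ b', g b' (Function.update σ b v b') = g b v * ∏ b' ∈ Finset.univ.erase b, g b' (σ b') := by
  rw [← Finset.mul_prod_erase _ _ (Finset.mem_univ b), Function.update_self]
  congr 1
  refine Finset.prod_congr rfl fun b' hb' => ?_
  rw [Function.update_of_ne (Finset.ne_of_mem_erase hb')]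

lemma qSymm_oneTensor_projP {q : ℂ} (hq : q ≠ 0) {t N : ℕ} (p : Fin 2 × (Fin (t * N) → Fin 2))
    (b : Fin N) {i j : Fin t} (hj : (j : ℕ) = i + 1) :
    QSymm q (blockIdx t N b i) (blockIdx t N b j) (oneTensor t N (projP q t) p) := by
  intro a τ
  simp only [oneTensor_apply, splitBlocks_update, Function.update_self, Function.update_idem]
  rw [prod_comp_update (fun b' => projP q t (splitBlocks t N p.2 b')),
    prod_comp_update (fun b' => projP q t (splitBlocks t N p.2 b')), projP_update_pair hq _ _ hj]
  ring

/-- A covector that is q-symmetric inside every block is fixed by block operators which preserve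
the magnetisation and fix the q-symmetric covectors of a single block. -/
lemma vecMul_oneTensor_of_qSymm {q : ℂ} (hq : q ≠ 0) {t N : ℕ}
    {x : Fin 2 × (Fin (t * N) → Fin 2) → ℂ}
    (hx : ∀ (b : Fin N) (i j : Fin t), (j : ℕ) = i + 1 →
      QSymm q (blockIdx t N b i) (blockIdx t N b j) x)
    {A : Matrix (Fin t → Fin 2) (Fin t → Fin 2) ℂ}
    (hA : ∀ v s, (downs v).card ≠ (downs s).card → A v s = 0)
    (hA' : ∀ s, ∑ v, q ^ (idxSum v - idxSum s) * A v s = 1) :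
    Matrix.vecMul x (oneTensor t N A) = x := by
  funext ⟨c, τ⟩
  obtain ⟨σ, rfl⟩ := (splitBlocks t N).symm.surjective τ
  have hinv : ∀ ρ : Fin N → Fin t → Fin 2, (∀ b, (downs (σ b)).card = (downs (ρ b)).card) →
      x (c, (splitBlocks t N).symm ρ) * ∏ b, q ^ (-idxSum (ρ b)) =
      x (c, (splitBlocks t N).symm σ) * ∏ b, q ^ (-idxSum (σ b)) := by
    intro ρ hρ
    refine eq_of_forall_update_eq (fun v v' => (downs v).card = (downs v').card)
      (fun ρ => x (c, (splitBlocks t N).symm ρ) * ∏ b, q ^ (-idxSum (ρ b))) ?_ hρ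
    intro ρ b v hv
    have hf := eq_of_card_downs_eq
      (fun v => x (c, (splitBlocks t N).symm (Function.update ρ b v)) * q ^ (-idxSum v))
      (fun i j hj s => by
        simp only [splitBlocks_symm_update, hx b i j hj c _, idxSum_update_pair s hj]
        rw [neg_add, zpow_add₀ hq, zpow_neg_one]
        field_simp) hv
    simp only [Function.update_eq_self] at hf
    have hp := prod_comp_update (fun _ s => q ^ (-idxSum s)) ρ b
    have hp' := hp (ρ b)
    simp only [Function.update_eq_self] at hp'
    simp only [hp, hp']
    rw [← mul_assoc, ← mul_assoc, hf]
  rw [Matrix.vecMul, dotProduct, Fintype.sum_prod_type, Finset.sum_eq_single c,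
    ← Equiv.sum_comp (splitBlocks t N).symm]
  · have hterm : ∀ ρ : Fin N → Fin t → Fin 2,
        x (c, (splitBlocks t N).symm ρ) * oneTensor t N A (c, (splitBlocks t N).symm ρ)
          (c, (splitBlocks t N).symm σ) =
        x (c, (splitBlocks t N).symm σ) *
          ∏ b, q ^ (idxSum (ρ b) - idxSum (σ b)) * A (ρ b) (σ b) := by
      intro ρ
      simp only [oneTensor_apply, Equiv.apply_symm_apply, if_true, one_mul]
      by_cases h : ∀ b, (downs (σ b)).card = (downs (ρ b)).card
      · have h1 := hinv ρ h
        rw [Finset.prod_mul_distrib, ← mul_assoc]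
        congr 1
        simp only [sub_eq_neg_add, zpow_add₀ hq, Finset.prod_mul_distrib]
        rw [← mul_assoc, ← h1, mul_assoc, ← Finset.prod_mul_distrib]
        simp only [← zpow_add₀ hq, neg_add_cancel, zpow_zero, Finset.prod_const_one, mul_one]
      · push Not at h
        obtain ⟨b, hb⟩ := h
        rw [Finset.prod_eq_zero (Finset.mem_univ b) (hA _ _ hb.symm),
          Finset.prod_eq_zero (Finset.mem_univ b) (by rw [hA _ _ hb.symm, mul_zero])]
        simp
    simp only [hterm]
    rw [← Finset.mul_sum, ← Fintype.piFinset_univ,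
      ← Finset.prod_univ_sum (fun _ => Finset.univ)
        (fun b v => q ^ (idxSum v - idxSum (σ b)) * A v (σ b))]
    simp [hA']
  · intro a _ ha
    simp [oneTensor_apply, ha]
  · simp

lemma QSymm.vecMul_prod_of_notMem {L : ℕ} {q η : ℂ} {i j : Fin L} (u : Fin L → ℂ)
    (l : List (Fin L)) (hi : i ∉ l) (hj : j ∉ l) {x : Fin 2 × (Fin L → Fin 2) → ℂ}
    (hx : QSymm q i j x) :
    QSymm q i j (Matrix.vecMul x (l.map fun k => R0j η L k (u k)).prod) := by
  induction l generalizing x with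
  | nil => simpa using hx
  | cons k l ih =>
    simp only [List.mem_cons, not_or] at hi hj
    rw [List.map_cons, List.prod_cons, ← Matrix.vecMul_vecMul]
    exact ih hi.2 hj.2 (hx.vecMul_R0j_of_ne (Ne.symm hi.1) (Ne.symm hj.1))

lemma finRange_eq_append_pair {L : ℕ} {i j : Fin L} (hj : (j : ℕ) = i + 1) :
    ∃ l₁ l₂ : List (Fin L), List.finRange L = l₁ ++ i :: j :: l₂ := by
  refine ⟨(List.finRange L).take i, (List.finRange L).drop (i + 2), ?_⟩
  conv_lhs => rw [← List.take_append_drop i (List.finRange L)]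
  congr 1
  rw [List.drop_eq_getElem_cons (by simp), List.drop_eq_getElem_cons (by simp; omega)]
  simp only [List.getElem_finRange]
  congr 1
  congr 1
  exact Fin.ext (by simp [hj])

lemma QSymm.vecMul_monodromy {L : ℕ} {η lam : ℂ} {w : Fin L → ℂ} {i j : Fin L}
    (hj : (j : ℕ) = i + 1) (hw : w j = w i - η)
    (hreg : ∀ k, Complex.sinh (lam - w k + η) ≠ 0)
    {x : Fin 2 × (Fin L → Fin 2) → ℂ} (hx : QSymm (Complex.exp η) i j x) :
    QSymm (Complex.exp η) i j (Matrix.vecMul x (monodromy η L lam w)) := by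
  obtain ⟨l₁, l₂, h⟩ := finRange_eq_append_pair hj
  have hnd := List.nodup_finRange L
  rw [h] at hnd
  have hij : i ≠ j := by rintro rfl; omega
  have hi₁ : i ∉ l₁ := fun hm => (List.nodup_append.mp hnd).2.2 i hm i (by simp) rfl
  have hj₁ : j ∉ l₁ := fun hm => (List.nodup_append.mp hnd).2.2 j hm j (by simp) rfl
  have hnd₂ := (List.nodup_append.mp hnd).2.1
  simp only [List.nodup_cons, List.mem_cons, not_or] at hnd₂
  have huj : lam - w j = lam - w i + η := by rw [hw]; ring
  have hrj := hreg j
  rw [huj] at hrj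
  have hprod : monodromy η L lam w = (l₂.reverse.map fun k => R0j η L k (lam - w k)).prod *
      R0j η L j (lam - w i + η) * R0j η L i (lam - w i) *
        (l₁.reverse.map fun k => R0j η L k (lam - w k)).prod := by
    rw [monodromy, h, ← huj]
    simp [mul_assoc]
  rw [hprod, ← Matrix.vecMul_vecMul, ← Matrix.vecMul_vecMul, ← Matrix.vecMul_vecMul]
  refine QSymm.vecMul_prod_of_notMem _ _ (by simpa using hi₁) (by simpa using hj₁) ?_
  refine QSymm.vecMul_R0j_pair hij (hreg i) hrj ?_
  exact hx.vecMul_prod_of_notMem _ _ (by simpa using hnd₂.1.2) (by simpa using hnd₂.2.1)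

/-- Projection operators commute with the monodromy matrix at complete 2s-strings
(Lemma of Section 3.9), with t = 2s: (1⊗P) T(λ) (1⊗P) = (1⊗P) T(λ) and
(1⊗P) T(λ) (1⊗P̃) = (1⊗P) T(λ). -/
theorem stmt12 (t N : ℕ) (ht : 1 ≤ t) (hN : 1 ≤ N)
    (η : ℂ) (ξ : Fin N → ℂ) (q : ℂ) (hq : q = Complex.exp η)
    (hroot : ∀ k : ℕ, 1 ≤ k → k ≤ t → q ^ (2 * k) ≠ 1)
    (w : Fin (t * N) → ℂ)
    (hw : ∀ (b : Fin N) (β : Fin t), w (blockIdx t N b β) = ξ b - ((β : ℕ) : ℂ) * η)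
    (lam : ℂ) (hreg : ∀ j : Fin (t * N), Complex.sinh (lam - w j + η) ≠ 0) :
    oneTensor t N (projP q t) * monodromy η (t * N) lam w * oneTensor t N (projP q t) =
      oneTensor t N (projP q t) * monodromy η (t * N) lam w ∧
    oneTensor t N (projP q t) * monodromy η (t * N) lam w * oneTensor t N (projPt q t) =
      oneTensor t N (projP q t) * monodromy η (t * N) lam w := by
  subst hq
  have hq := Complex.exp_ne_zero η
  have hsymm : ∀ (p : Fin 2 × (Fin (t * N) → Fin 2)) (b : Fin N) (i j : Fin t),
      (j : ℕ) = i + 1 → QSymm (Complex.exp η) (blockIdx t N b i) (blockIdx t N b j)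
        ((oneTensor t N (projP (Complex.exp η) t) * monodromy η (t * N) lam w) p) := by
    intro p b i j hj
    rw [Matrix.mul_apply_eq_vecMul]
    refine (qSymm_oneTensor_projP hq p b hj).vecMul_monodromy ?_ ?_ hreg
    · simp [blockIdx, hj, add_assoc]
    · rw [hw, hw, hj]
      push_cast
      ring
  constructor
  · funext p
    rw [Matrix.mul_apply_eq_vecMul]
    refine vecMul_oneTensor_of_qSymm hq (hsymm p) (fun v s h => ?_) (sum_zpow_mul_projP hq hroot)
    rw [projP_apply, ketV, if_neg h, zero_mul]
  · funext p
    rw [Matrix.mul_apply_eq_vecMul]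
    refine vecMul_oneTensor_of_qSymm hq (hsymm p) (fun v s h => ?_) (sum_zpow_mul_projPt hq hroot)
    rw [projPt_apply, ketTilde, if_neg h, mul_zero, zero_mul]
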